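/- Fix R ∈ ℝ. There exist ε₀ > 0 and C > 0 such that for every ε ∈ (0, ε₀] and every locally absolutely continuous ψ : ℝ → ℂ with ρ_R(ψ, φ) ≤ ε², the function ψ is bounded on ℝ and the function η = |ψ|² - φ² satisfies sup_{x ≥ R} |η(x)| ≤ C ε. -/

import Mathlib

open Real MeasureTheory Set ENNReal

noncomputable def φ (x : ℝ) : ℝ := Real.sqrt ((1 + Real.tanh x) / 2)

/-- The weight of the Hilbert space `𝓗_R`. -/
noncomputable def W (R x : ℝ) : ℝ :=
  if x ≤ R then 1 else (1 - (φ x) ^ 2) / (1 - (φ R) ^ 2)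

/-- The distance `ρ_R(ψ, φ)` to the kink. -/
noncomputable def rho (R : ℝ) (ψ : ℝ → ℂ) : ℝ≥0∞ :=
  (∫⁻ x : ℝ, (‖deriv ψ x - ((deriv φ x : ℝ) : ℂ)‖₊ : ℝ≥0∞) ^ 2) +
  (∫⁻ x : ℝ, ENNReal.ofReal (W R x) * (‖ψ x - (φ x : ℂ)‖₊ : ℝ≥0∞) ^ 2) +
  ∫⁻ x in Ioi R, ENNReal.ofReal ((‖ψ x‖ ^ 2 - (φ x) ^ 2) ^ 2)

lemma phi_sq (x : ℝ) : (φ x) ^ 2 = (1 + Real.tanh x) / 2 := by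
  unfold φ
  apply Real.sq_sqrt
  have := Real.neg_one_lt_tanh x
  linarith

lemma one_sub_phi_sq (x : ℝ) : 1 - (φ x) ^ 2 = 1 / (1 + Real.exp (2 * x)) := by
  rw [phi_sq, Real.tanh_eq_sinh_div_cosh, Real.sinh_eq, Real.cosh_eq]
  have h1 : Real.exp (2 * x) = Real.exp x * Real.exp x := by rw [← Real.exp_add]; ring_nf
  have h2 : Real.exp (-x) = 1 / Real.exp x := by rw [Real.exp_neg]; simp
  rw [h1, h2]
  have := Real.exp_pos x
  field_simp
  ring

lemma phi_nonneg (x : ℝ) : 0 ≤ φ x := Real.sqrt_nonneg _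

lemma one_sub_pos (x : ℝ) : 0 < 1 - (φ x) ^ 2 := by
  rw [one_sub_phi_sq]; positivity

lemma phi_le_one (x : ℝ) : φ x ≤ 1 := by
  have := one_sub_pos x
  nlinarith [phi_nonneg x]

lemma one_sub_anti {x y : ℝ} (h : x ≤ y) : 1 - (φ y) ^ 2 ≤ 1 - (φ x) ^ 2 := by
  rw [one_sub_phi_sq, one_sub_phi_sq]
  have : Real.exp (2 * x) ≤ Real.exp (2 * y) := Real.exp_le_exp.2 (by linarith)
  have := Real.exp_pos (2 * x)
  gcongr

lemma phi_mono {x y : ℝ} (h : x ≤ y) : φ x ≤ φ y := by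
  have := one_sub_anti h
  exact abs_le_of_sq_le_sq' (by linarith) (phi_nonneg y) |>.2

lemma one_sub_compare {x y : ℝ} (h : y ≤ x + 1) :
    1 - (φ x) ^ 2 ≤ Real.exp 2 * (1 - (φ y) ^ 2) := by
  rw [one_sub_phi_sq, one_sub_phi_sq]
  have h1 : Real.exp (2 * y) ≤ Real.exp 2 * Real.exp (2 * x) := by
    rw [← Real.exp_add]; exact Real.exp_le_exp.2 (by linarith)
  have h2 := Real.exp_pos (2 * x)
  have h3 := Real.exp_pos (2 * y)
  have h4 : 1 ≤ Real.exp 2 := Real.one_le_exp (by norm_num)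
  rw [mul_one_div, div_le_div_iff₀ (by positivity) (by positivity)]
  nlinarith

lemma phi_diff : Differentiable ℝ φ := by
  intro x
  unfold φ
  have h := Real.neg_one_lt_tanh x
  have ht : DifferentiableAt ℝ Real.tanh x := by
    have : Real.tanh = fun x => Real.sinh x / Real.cosh x := by
      funext x; exact Real.tanh_eq_sinh_div_cosh x
    rw [this]
    exact (Real.differentiable_sinh x).div (Real.differentiable_cosh x) (Real.cosh_pos x).ne'
  apply DifferentiableAt.sqrt
  · fun_prop
  · have : (0:ℝ) < (1 + Real.tanh x) / 2 := by linarith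
    exact this.ne'

lemma W_meas (R : ℝ) : Measurable (W R) := by
  unfold W
  have := phi_diff.continuous.measurable
  exact Measurable.ite measurableSet_Iic (by fun_prop) (by fun_prop)

/-- Local control of increments by the energy of the derivative. -/
lemma increment_bound (f : ℝ → ℂ) (hf : Differentiable ℝ f) (ε : ℝ) (hε : 0 < ε)
    (hI : ∫⁻ x : ℝ, (‖deriv f x‖₊ : ℝ≥0∞) ^ 2 ≤ ENNReal.ofReal (ε ^ 2))
    (x y : ℝ) (hxy : x ≤ y) (hy : y ≤ x + 1) : ‖f y - f x‖ ≤ ε := by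
  have hm : Measurable (deriv f) := measurable_deriv f
  have he : ∀ t, (‖deriv f t‖₊ : ℝ≥0∞) ^ 2 = ENNReal.ofReal (‖deriv f t‖ ^ 2) := by
    intro t
    rw [ENNReal.ofReal_pow (norm_nonneg _), ofReal_norm_eq_enorm]; rfl
  simp_rw [he] at hI
  have hint : Integrable (fun t => ‖deriv f t‖ ^ 2) := by
    refine ⟨by fun_prop, ?_⟩
    rw [hasFiniteIntegral_iff_ofReal (Filter.Eventually.of_forall fun t => by positivity)]
    exact lt_of_le_of_lt hI ENNReal.ofReal_lt_top
  have hle : ∫ t, ‖deriv f t‖ ^ 2 ≤ ε ^ 2 := by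
    rw [← ofReal_integral_eq_lintegral_ofReal hint
      (Filter.Eventually.of_forall fun t => by positivity)] at hI
    exact (ENNReal.ofReal_le_ofReal_iff (by positivity)).1 hI
  have hpt : ∀ t, ‖deriv f t‖ ≤ (ε + ‖deriv f t‖ ^ 2 / ε) / 2 := by
    intro t
    have : 0 ≤ (ε - ‖deriv f t‖) ^ 2 / ε := by positivity
    have h2 : (ε - ‖deriv f t‖) ^ 2 / ε = ε + ‖deriv f t‖ ^ 2 / ε - 2 * ‖deriv f t‖ := by
      field_simp; ring
    linarith
  have hdom : IntervalIntegrable (fun t => (ε + ‖deriv f t‖ ^ 2 / ε) / 2) volume x y :=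
    ((intervalIntegrable_const).add (hint.intervalIntegrable.div_const ε)).div_const 2
  have hii : IntervalIntegrable (deriv f) volume x y := by
    refine hdom.mono_fun hm.aestronglyMeasurable (Filter.Eventually.of_forall fun t => ?_)
    exact (hpt t).trans (le_abs_self _)
  rw [← intervalIntegral.integral_eq_sub_of_hasDerivAt
    (fun t _ => (hf t).hasDerivAt) hii]
  calc ‖∫ t in x..y, deriv f t‖ ≤ ∫ t in x..y, ‖deriv f t‖ :=
        intervalIntegral.norm_integral_le_integral_norm hxy
    _ ≤ ∫ t in x..y, (ε + ‖deriv f t‖ ^ 2 / ε) / 2 :=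
        intervalIntegral.integral_mono_on hxy hii.norm hdom (fun t _ => hpt t)
    _ = ((y - x) * ε + (∫ t in x..y, ‖deriv f t‖ ^ 2) / ε) / 2 := by
        rw [intervalIntegral.integral_div, intervalIntegral.integral_add
          intervalIntegrable_const (hint.intervalIntegrable.div_const ε),
          intervalIntegral.integral_div]
        simp
    _ ≤ (1 * ε + ε ^ 2 / ε) / 2 := by
        have : ∫ t in x..y, ‖deriv f t‖ ^ 2 ≤ ε ^ 2 := by
          rw [intervalIntegral.integral_of_le hxy]
          exact (setIntegral_le_integral hint
            (Filter.Eventually.of_forall fun t => by positivity)).trans hle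
        gcongr
        linarith
    _ = ε := by field_simp; ring

lemma exists_good_point (g : ℝ → ℝ≥0∞) (hg : Measurable g) (a : ℝ) (c : ℝ≥0∞)
    (h : ∫⁻ t in Ioo a (a + 1), g t ≤ c) : ∃ y ∈ Ioo a (a + 1), g y ≤ c := by
  obtain ⟨y, hy, hle⟩ := exists_le_setLAverage (μ := volume) (s := Ioo a (a + 1)) (f := g)
    (by simp) (by simp) hg.aemeasurable
  refine ⟨y, hy, hle.trans ?_⟩
  rw [setLAverage_eq]
  simpa using h

theorem eta_supremum_bound (R : ℝ) :
    ∃ ε₀ > (0 : ℝ), ∃ C > (0 : ℝ), ∀ ε : ℝ, 0 < ε → ε ≤ ε₀ →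
      ∀ ψ : ℝ → ℂ, Differentiable ℝ ψ →
        rho R ψ ≤ ENNReal.ofReal (ε ^ 2) →
        (∃ M : ℝ, ∀ x : ℝ, ‖ψ x‖ ≤ M) ∧
        ∀ x : ℝ, R ≤ x → |‖ψ x‖ ^ 2 - (φ x) ^ 2| ≤ C * ε := by
  refine ⟨1, one_pos, 11 + 2 * Real.exp 2, by positivity, ?_⟩
  intro ε hε hε1 ψ hψ hrho
  unfold rho at hrho
  obtain ⟨f, hfdef⟩ : ∃ f : ℝ → ℂ, f = fun x => ψ x - (φ x : ℂ) := ⟨_, rfl⟩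
  have hfx : ∀ x, f x = ψ x - (φ x : ℂ) := fun x => by rw [hfdef]
  have hder : ∀ x, HasDerivAt f (deriv ψ x - ((deriv φ x : ℝ) : ℂ)) x := by
    intro x
    rw [hfdef]
    exact (hψ x).hasDerivAt.sub (phi_diff x).hasDerivAt.ofReal_comp
  have hfd : Differentiable ℝ f := fun x => (hder x).differentiableAt
  have hI : ∫⁻ x : ℝ, (‖deriv f x‖₊ : ℝ≥0∞) ^ 2 ≤ ENNReal.ofReal (ε ^ 2) := by
    simp_rw [fun x => (hder x).deriv]
    exact le_trans (le_trans le_self_add le_self_add) hrho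
  have hinc := increment_bound f hfd ε hε hI
  have hφm := phi_diff.continuous.measurable
  have hψm := hψ.continuous.measurable
  have hWm := W_meas R
  have hsq : ∀ z : ℂ, (‖z‖₊ : ℝ≥0∞) ^ 2 = ENNReal.ofReal (‖z‖ ^ 2) := by
    intro z
    rw [ENNReal.ofReal_pow (norm_nonneg _), ofReal_norm_eq_enorm]; rfl
  simp_rw [← hfx, hsq] at hrho
  have hg1 : Measurable fun x => ENNReal.ofReal (W R x) * ENNReal.ofReal (‖f x‖ ^ 2) := by
    have := hfd.continuous.measurable
    fun_prop
  have hg2 : Measurable fun x => ENNReal.ofReal ((‖ψ x‖ ^ 2 - (φ x) ^ 2) ^ 2) := by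
    fun_prop
  -- left half line
  have hleft : ∀ x ≤ R, ‖f x‖ ≤ 2 * ε := by
    intro x hx
    obtain ⟨y, hy, hyle⟩ := exists_good_point _ hg1 (x - 1) (ENNReal.ofReal (ε ^ 2))
      (le_trans (setLIntegral_le_lintegral _ _) (le_trans (le_trans le_add_self le_self_add) hrho))
    have hyR : y ≤ R := by linarith [hy.2]
    have hW : W R y = 1 := by simp [W, hyR]
    rw [hW, ENNReal.ofReal_one, one_mul, ENNReal.ofReal_le_ofReal_iff (by positivity)] at hyle
    have h1 : ‖f y‖ ≤ ε := abs_le_of_sq_le_sq' hyle hε.le |>.2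
    have h2 := hinc y x (by linarith [hy.2]) (by linarith [hy.1])
    have h3 := norm_le_norm_add_norm_sub (f y) (f x)
    rw [norm_sub_rev] at h3
    linarith
  -- right half line
  have hright : ∀ x, R ≤ x → ∃ y, x ≤ y ∧ y ≤ x + 1 ∧ W R y * ‖f y‖ ^ 2 ≤ ε ^ 2 ∧
      |‖ψ y‖ ^ 2 - (φ y) ^ 2| ≤ ε ∧ R < y := by
    intro x hx
    obtain ⟨y, hy, hyle⟩ := exists_good_point _ (hg1.add hg2) x (ENNReal.ofReal (ε ^ 2)) (by
      have : ∫⁻ t in Ioo x (x + 1), ((fun x => ENNReal.ofReal (W R x) * ENNReal.ofReal (‖f x‖ ^ 2))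
          + fun x => ENNReal.ofReal ((‖ψ x‖ ^ 2 - (φ x) ^ 2) ^ 2)) t =
          (∫⁻ t in Ioo x (x + 1), ENNReal.ofReal (W R t) * ENNReal.ofReal (‖f t‖ ^ 2)) +
          ∫⁻ t in Ioo x (x + 1), ENNReal.ofReal ((‖ψ t‖ ^ 2 - (φ t) ^ 2) ^ 2) :=
        lintegral_add_left hg1 _
      rw [this]
      refine le_trans ?_ hrho
      refine add_le_add (le_trans (setLIntegral_le_lintegral _ _) le_add_self) ?_
      exact lintegral_mono_set fun t ht => lt_of_le_of_lt hx ht.1)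
    have hyR : R < y := lt_of_le_of_lt hx hy.1
    have hW0 : 0 ≤ W R y := by
      simp only [W, not_le.2 hyR, if_false]
      exact (div_pos (one_sub_pos y) (one_sub_pos R)).le
    simp only [Pi.add_apply] at hyle
    rw [← ENNReal.ofReal_mul hW0] at hyle
    refine ⟨y, hy.1.le, hy.2.le, ?_, ?_, hyR⟩
    · exact (ENNReal.ofReal_le_ofReal_iff (by positivity)).1 (le_trans le_self_add hyle)
    · have := (ENNReal.ofReal_le_ofReal_iff (by positivity)).1 (le_trans le_add_self hyle)
      exact abs_le_of_sq_le_sq this hε.le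
  have hψf : ∀ x, ψ x = f x + (φ x : ℂ) := fun x => by rw [hfx]; ring
  have hφn : ∀ x, ‖(φ x : ℂ)‖ = φ x := fun x => by
    rw [Complex.norm_real, Real.norm_eq_abs, abs_of_nonneg (phi_nonneg x)]
  have hfy : ∀ y, |‖ψ y‖ ^ 2 - (φ y) ^ 2| ≤ ε → ‖f y‖ ≤ 3 := by
    intro y hy
    have h1 : ‖ψ y‖ ≤ 2 := by
      have := (abs_le.1 hy).2
      nlinarith [phi_le_one y, phi_nonneg y, norm_nonneg (ψ y)]
    rw [hfx]
    have := norm_sub_le (ψ y) (φ y : ℂ)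
    rw [hφn] at this
    linarith [phi_le_one y]
  have hfb : ∀ x, R ≤ x → ‖f x‖ ≤ 4 := by
    intro x hx
    obtain ⟨y, h1, h2, h3, h4, h5⟩ := hright x hx
    have := hinc x y h1 h2
    have h6 := norm_le_norm_add_norm_sub (f y) (f x)
    linarith [hfy y h4]
  refine ⟨⟨5, fun x => ?_⟩, fun x hx => ?_⟩
  · rw [hψf]
    have h := norm_add_le (f x) (φ x : ℂ)
    rw [hφn] at h
    have := phi_le_one x
    rcases le_total x R with hx | hx
    · linarith [hleft x hx]
    · linarith [hfb x hx]
  · obtain ⟨y, h1, h2, h3, h4, h5⟩ := hright x hx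
    have hη : ∀ t, ‖ψ t‖ ^ 2 - (φ t) ^ 2 = ‖f t‖ ^ 2 + 2 * φ t * (f t).re := by
      intro t
      rw [hψf, ← Complex.normSq_eq_norm_sq, ← Complex.normSq_eq_norm_sq,
        Complex.normSq_apply, Complex.normSq_apply]
      simp
      ring
    have hd := hinc x y h1 h2
    have hfx4 := hfb x hx
    have hfy3 := hfy y h4
    have hre : |(f y).re - (f x).re| ≤ ε := by
      rw [← Complex.sub_re]; exact (Complex.abs_re_le_norm _).trans hd
    have hnorm : |‖f y‖ - ‖f x‖| ≤ ε := (abs_norm_sub_norm_le _ _).trans hd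
    -- first piece
    have p1 : |‖f x‖ ^ 2 - ‖f y‖ ^ 2| ≤ 8 * ε := by
      have : ‖f x‖ ^ 2 - ‖f y‖ ^ 2 = -((‖f y‖ - ‖f x‖) * (‖f x‖ + ‖f y‖)) := by ring
      rw [this, abs_neg, abs_mul, abs_of_nonneg (by positivity : 0 ≤ ‖f x‖ + ‖f y‖)]
      nlinarith [norm_nonneg (f x), norm_nonneg (f y)]
    have p2 : |2 * φ x * ((f x).re - (f y).re)| ≤ 2 * ε := by
      rw [abs_mul, abs_of_nonneg (by linarith [phi_nonneg x]), abs_sub_comm]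
      nlinarith [phi_nonneg x, phi_le_one x, abs_nonneg ((f y).re - (f x).re)]
    have p3 : |2 * (φ x - φ y) * (f y).re| ≤ 2 * Real.exp 2 * ε := by
      have hWeq : W R y = (1 - (φ y) ^ 2) / (1 - (φ R) ^ 2) := by
        simp [W, not_le.2 h5]
      have hR := one_sub_pos R
      have hyp := one_sub_pos y
      have hW0 : 0 ≤ W R y := by rw [hWeq]; exact (div_pos hyp hR).le
      have hW1 : W R y ≤ 1 := by rw [hWeq, div_le_one hR]; exact one_sub_anti h5.le
      have hW2 : 1 - (φ y) ^ 2 ≤ W R y := by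
        rw [hWeq, le_div_iff₀ hR]; nlinarith [sq_nonneg (φ R)]
      have hWf : W R y * ‖f y‖ ≤ ε := by
        apply abs_le_of_sq_le_sq' _ hε.le |>.2
        have : W R y * (W R y * ‖f y‖ ^ 2) ≤ 1 * ε ^ 2 := by gcongr
        nlinarith
      have hmono := phi_mono h1
      have hdφ : |φ x - φ y| ≤ Real.exp 2 * W R y := by
        rw [abs_sub_comm, abs_of_nonneg (by linarith)]
        have ha : φ y - φ x ≤ 1 - (φ x) ^ 2 := by
          nlinarith [phi_le_one y, phi_le_one x, phi_nonneg x]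
        have hb := one_sub_compare h2
        have hc : Real.exp 2 * (1 - (φ y) ^ 2) ≤ Real.exp 2 * W R y := by gcongr
        linarith
      rw [abs_mul, abs_mul, abs_two]
      calc 2 * |φ x - φ y| * |(f y).re| ≤ 2 * (Real.exp 2 * W R y) * ‖f y‖ := by
            gcongr
            exact Complex.abs_re_le_norm _
        _ = 2 * Real.exp 2 * (W R y * ‖f y‖) := by ring
        _ ≤ 2 * Real.exp 2 * ε := by gcongr
    have hsplit : ‖ψ x‖ ^ 2 - (φ x) ^ 2 = (‖ψ y‖ ^ 2 - (φ y) ^ 2) + (‖f x‖ ^ 2 - ‖f y‖ ^ 2)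
        + 2 * φ x * ((f x).re - (f y).re) + 2 * (φ x - φ y) * (f y).re := by
      rw [hη x, hη y]; ring
    rw [hsplit]
    rw [abs_le] at *
    constructor <;> linarith [h4.1, h4.2, p1.1, p1.2, p2.1, p2.2, p3.1, p3.2]
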